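/- Given any γ > 0 there exists an integer n₀ = n₀(γ) such that the following holds. Suppose H is a 3-uniform hypergraph on n ≥ n₀ vertices with δ₁(H) ≥ (1/2 + 2γ)·C(n,2) (where C(a,b) denotes the binomial coefficient). Then there is a matching M* in H of size |M*| ≤ γ³n/3 such that for every set V' ⊆ V(H) \ V(M*) with |V'| ≤ γ⁶n and |V'| divisible by 3, there is a matching in H covering precisely the vertices in V(M*) ∪ V'. -/

import Mathlib

open Finset

namespace Absorbing

variable {V : Type} [Fintype V] [DecidableEq V]

/-- The ordered pairs that form an edge of `H` together with `v`. -/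
def link (H : Finset (Finset V)) (v : V) : Finset (V × V) :=
  univ.filter fun p => {v, p.1, p.2} ∈ H

/-- A candidate absorber `((x, y), (a, b), (c, d))` stands for the two triples
`{x, a, b}` and `{y, c, d}`. -/
abbrev Gadget (V : Type) := (V × V) × (V × V) × (V × V)

/-- The first triple of a gadget. -/
def fstTriple (t : Gadget V) : Finset V := {t.1.1, t.2.1.1, t.2.1.2}

/-- The second triple of a gadget. -/
def sndTriple (t : Gadget V) : Finset V := {t.1.2, t.2.2.1, t.2.2.2}

/-- The vertices of a gadget. -/
def verts (t : Gadget V) : Finset V := fstTriple t ∪ sndTriple t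

/-- The two triples of the gadget form a matching in `H`. -/
def IsGood (H : Finset (Finset V)) (t : Gadget V) : Prop :=
  fstTriple t ∈ H ∧ sndTriple t ∈ H ∧ Disjoint (fstTriple t) (sndTriple t)

/-- A good gadget which, together with the three vertices of `T`, can be
rearranged into three triples of `H`. -/
def Absorbs (H : Finset (Finset V)) (T : V × V × V) (t : Gadget V) : Prop :=
  IsGood H t ∧ t.1 ∈ link H T.1 ∧ t.2.1 ∈ link H T.2.1 ∧ t.2.2 ∈ link H T.2.2

lemma mem_link {H : Finset (Finset V)} {v : V} {p : V × V} :
    p ∈ link H v ↔ {v, p.1, p.2} ∈ H := by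
  simp [link]

omit [Fintype V] in
lemma distinct_of_mem {H : Finset (Finset V)} (hH : ∀ e ∈ H, e.card = 3) {x y z : V}
    (h : {x, y, z} ∈ H) : x ≠ y ∧ x ≠ z ∧ y ≠ z := by
  have h3 := hH _ h
  refine ⟨?_, ?_, ?_⟩ <;> rintro rfl
  · have := card_le_two (a := x) (b := z)
    simp only [insert_idem] at h3
    omega
  · have := card_le_two (a := y) (b := x)
    rw [insert_comm] at h3
    simp only [insert_eq_of_mem, mem_singleton] at h3
    omega
  · have := card_le_two (a := x) (b := y)
    simp only [mem_singleton, insert_eq_of_mem] at h3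
    omega

lemma two_mul_degree_le_card_link {H : Finset (Finset V)} (hH : ∀ e ∈ H, e.card = 3) (v : V) :
    2 * (H.filter fun e => v ∈ e).card ≤ (link H v).card := by
  have hmaps : ∀ p ∈ link H v, ({v, p.1, p.2} : Finset V) ∈ H.filter fun e => v ∈ e := by
    intro p hp
    simpa using mem_link.1 hp
  rw [card_eq_sum_card_fiberwise hmaps, mul_comm, ← smul_eq_mul]
  refine card_nsmul_le_sum (H.filter fun e => v ∈ e) _ 2 fun e he => ?_
  obtain ⟨heH, hve⟩ := mem_filter.1 he
  have h2 : (e.erase v).card = 2 := by rw [card_erase_of_mem hve, hH e heH]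
  obtain ⟨a, b, hab, hE⟩ := card_eq_two.1 h2
  have hins : ({v, a, b} : Finset V) = e := by rw [← insert_erase hve, hE]
  have hins' : ({v, b, a} : Finset V) = e := by rw [← hins, pair_comm]
  have hsub : ({(a, b), (b, a)} : Finset (V × V)) ⊆
      (link H v).filter fun p => ({v, p.1, p.2} : Finset V) = e := by
    intro p hp
    simp only [mem_insert, mem_singleton] at hp
    rcases hp with rfl | rfl <;> simp [mem_link, hins, hins', heH]
  refine le_trans (le_of_eq ?_) (card_le_card hsub)
  rw [card_pair]
  simp [hab]

lemma link_subset_offDiag {H : Finset (Finset V)} (hH : ∀ e ∈ H, e.card = 3) (v : V) :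
    link H v ⊆ (univ : Finset V).offDiag := by
  intro p hp
  simpa using (distinct_of_mem hH (mem_link.1 hp)).2.2

omit [DecidableEq V] in
lemma cast_card_offDiag_univ :
    (((univ : Finset V).offDiag).card : ℝ) =
      (Fintype.card V : ℝ) * ((Fintype.card V : ℝ) - 1) := by
  rw [offDiag_card, Nat.cast_sub (Nat.le_mul_self _)]
  push_cast [card_univ]
  ring

lemma card_sub_le_card_avoiding (L : Finset (V × V)) (W : Finset V) :
    (L.card : ℝ) - 2 * W.card * Fintype.card V ≤
      ((L.filter fun p => p.1 ∉ W ∧ p.2 ∉ W).card : ℝ) := by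
  have hsub : L ⊆ (L.filter fun p => p.1 ∉ W ∧ p.2 ∉ W) ∪ (W ×ˢ univ ∪ univ ×ˢ W) := by
    intro p hp
    simp only [mem_union, mem_filter, mem_product, mem_univ, and_true, true_and]
    tauto
  have h1 := (card_le_card hsub).trans (card_union_le _ _)
  have h2 := card_union_le (W ×ˢ (univ : Finset V)) ((univ : Finset V) ×ˢ W)
  simp only [card_product, card_univ] at h2
  have h3 := h1.trans (Nat.add_le_add_left h2 _)
  have h4 : (L.card : ℝ) ≤ ((L.filter fun p => p.1 ∉ W ∧ p.2 ∉ W).card : ℝ) +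
      (W.card * Fintype.card V + Fintype.card V * W.card) := by exact_mod_cast h3
  linarith

lemma card_mul_le_card_of_fibers {α β : Type*} [DecidableEq α] [Fintype β] [DecidableEq β]
    (A : Finset α) (S : Finset (α × β)) (c : ℝ)
    (h : ∀ a ∈ A, c ≤ ((univ.filter fun b => (a, b) ∈ S).card : ℝ)) :
    (A.card : ℝ) * c ≤ S.card := by
  have hsub : (A.sigma fun a => univ.filter fun b => (a, b) ∈ S).card ≤ S.card := by
    refine card_le_card_of_injOn (fun x => (x.1, x.2)) ?_ ?_
    · rintro ⟨a, b⟩ hx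
      simp at hx
      exact hx.2
    · rintro ⟨a, b⟩ - ⟨a', b'⟩ - hx
      simp only [Prod.mk.injEq] at hx
      obtain ⟨rfl, rfl⟩ := hx
      rfl
  rw [card_sigma] at hsub
  calc (A.card : ℝ) * c = A.card • c := by simp
    _ ≤ ∑ a ∈ A, ((univ.filter fun b => (a, b) ∈ S).card : ℝ) := card_nsmul_le_sum _ _ _ h
    _ ≤ S.card := by exact_mod_cast hsub

section Counting

variable {γ : ℝ} {H : Finset (Finset V)}

lemma card_link_ge (hH : ∀ e ∈ H, e.card = 3)
    (hdeg : ∀ v : V, (1/2 + 2*γ) * ((Fintype.card V).choose 2 : ℝ)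
        ≤ ((H.filter fun e => v ∈ e).card : ℝ)) (v : V) :
    (1/2 + 2*γ) * ((Fintype.card V : ℝ) * ((Fintype.card V : ℝ) - 1)) ≤ (link H v).card := by
  have h1 := hdeg v
  rw [Nat.cast_choose_two] at h1
  have h2 : (2 : ℝ) * ((H.filter fun e => v ∈ e).card : ℝ) ≤ (link H v).card := by
    exact_mod_cast two_mul_degree_le_card_link hH v
  linarith

lemma le_quarter_of_degree (hH : ∀ e ∈ H, e.card = 3) (hn : 2 ≤ Fintype.card V)
    (hdeg : ∀ v : V, (1/2 + 2*γ) * ((Fintype.card V).choose 2 : ℝ)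
        ≤ ((H.filter fun e => v ∈ e).card : ℝ)) : γ ≤ 1/4 := by
  obtain ⟨v⟩ : Nonempty V := Fintype.card_pos_iff.1 (by omega)
  have h1 := card_link_ge hH hdeg v
  have h2 : ((link H v).card : ℝ) ≤ ((univ : Finset V).offDiag).card := by
    exact_mod_cast card_le_card (link_subset_offDiag hH v)
  rw [cast_card_offDiag_univ] at h2
  have hn' : (2 : ℝ) ≤ Fintype.card V := by exact_mod_cast hn
  have hpos : 0 < (Fintype.card V : ℝ) * ((Fintype.card V : ℝ) - 1) := by
    apply mul_pos <;> linarith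
  have h3 : (1/2 + 2*γ) ≤ 1 := by
    refine le_of_mul_le_mul_right ?_ hpos
    linarith
  linarith

lemma card_link_inter_ge (hH : ∀ e ∈ H, e.card = 3)
    (hdeg : ∀ v : V, (1/2 + 2*γ) * ((Fintype.card V).choose 2 : ℝ)
        ≤ ((H.filter fun e => v ∈ e).card : ℝ)) (u v : V) :
    4 * γ * ((Fintype.card V : ℝ) * ((Fintype.card V : ℝ) - 1)) ≤ (link H u ∩ link H v).card := by
  have hu := card_link_ge hH hdeg u
  have hv := card_link_ge hH hdeg v
  have h1 : ((link H u ∪ link H v).card : ℝ) ≤ ((univ : Finset V).offDiag).card := by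
    exact_mod_cast card_le_card
      (union_subset (link_subset_offDiag hH u) (link_subset_offDiag hH v))
  rw [cast_card_offDiag_univ] at h1
  have h2 : ((link H u ∪ link H v).card : ℝ) + (link H u ∩ link H v).card =
      (link H u).card + (link H v).card := by
    exact_mod_cast card_union_add_card_inter (link H u) (link H v)
  linarith

lemma card_link_avoiding_ge (hγ : 0 < γ) (hH : ∀ e ∈ H, e.card = 3)
    (hγ4 : γ ≤ 1/4) (hn : 4 ≤ (Fintype.card V : ℝ))
    (hdeg : ∀ v : V, (1/2 + 2*γ) * ((Fintype.card V).choose 2 : ℝ)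
        ≤ ((H.filter fun e => v ∈ e).card : ℝ)) (v : V)
    (W : Finset V) (hW : (W.card : ℝ) ≤ γ^3 * Fintype.card V) :
    (Fintype.card V : ℝ)^2 / 4 ≤
      (((link H v).filter fun p => p.1 ∉ W ∧ p.2 ∉ W).card : ℝ) := by
  have h1 := card_sub_le_card_avoiding (link H v) W
  have h2 := card_link_ge hH hdeg v
  set n : ℝ := (Fintype.card V : ℝ)
  have h3 : 2 * (W.card : ℝ) * n ≤ 2 * (γ^3 * n) * n := by gcongr
  have h4 : γ^3 ≤ γ := by nlinarith [mul_nonneg hγ.le hγ.le]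
  nlinarith [mul_nonneg (sub_nonneg.2 h4) (mul_nonneg (by linarith : (0:ℝ) ≤ n) (by linarith : (0:ℝ) ≤ n)),
    mul_nonneg (by linarith : (0:ℝ) ≤ n) (by linarith : (0:ℝ) ≤ n - 4),
    mul_nonneg (by linarith : (0:ℝ) ≤ n) (by linarith : (0:ℝ) ≤ 1/4 - γ)]

lemma card_link_inter_avoiding_ge (hγ : 0 < γ) (hH : ∀ e ∈ H, e.card = 3)
    (hγ4 : γ ≤ 1/4) (hn : 7 ≤ γ * (Fintype.card V : ℝ))
    (hdeg : ∀ v : V, (1/2 + 2*γ) * ((Fintype.card V).choose 2 : ℝ)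
        ≤ ((H.filter fun e => v ∈ e).card : ℝ)) (u v : V)
    (W : Finset V) (hW : (W.card : ℝ) ≤ γ^3 * Fintype.card V + 3) :
    2 * γ * (Fintype.card V : ℝ)^2 ≤
      (((link H u ∩ link H v).filter fun p => p.1 ∉ W ∧ p.2 ∉ W).card : ℝ) := by
  have h1 := card_sub_le_card_avoiding (link H u ∩ link H v) W
  have h2 := card_link_inter_ge hH hdeg u v
  have hn0 : (0 : ℝ) ≤ Fintype.card V := by positivity
  set n : ℝ := (Fintype.card V : ℝ)
  have h3 : 2 * (W.card : ℝ) * n ≤ 2 * (γ^3 * n + 3) * n := by gcongr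
  have h4 : γ^3 ≤ γ / 2 := by nlinarith [mul_nonneg hγ.le hγ.le]
  nlinarith [mul_nonneg (sub_nonneg.2 h4) (mul_nonneg hn0 hn0),
    mul_nonneg hn0 (sub_nonneg.2 hn), mul_nonneg hn0 (sub_nonneg.2 hγ4)]

open scoped Classical in
lemma card_absorbs_ge (hγ : 0 < γ) (hH : ∀ e ∈ H, e.card = 3)
    (hγ4 : γ ≤ 1/4) (hn : 7 ≤ γ * (Fintype.card V : ℝ))
    (hdeg : ∀ v : V, (1/2 + 2*γ) * ((Fintype.card V).choose 2 : ℝ)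
        ≤ ((H.filter fun e => v ∈ e).card : ℝ)) (T : V × V × V)
    (U : Finset V) (hU : (U.card : ℝ) ≤ γ^3 * Fintype.card V) :
    γ^2 * (Fintype.card V : ℝ)^6 ≤
      ((univ.filter fun t : Gadget V => Absorbs H T t ∧ Disjoint (verts t) U).card : ℝ) := by
  have hn4 : 4 ≤ (Fintype.card V : ℝ) := by
    have : (0 : ℝ) ≤ Fintype.card V := by positivity
    nlinarith
  have hP := card_link_avoiding_ge hγ hH hγ4 hn4 hdeg T.1 U hU
  have key := card_mul_le_card_of_fibers ((link H T.1).filter fun p => p.1 ∉ U ∧ p.2 ∉ U)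
    (univ.filter fun t : Gadget V => Absorbs H T t ∧ Disjoint (verts t) U)
    ((2 * γ * (Fintype.card V : ℝ)^2) * (2 * γ * (Fintype.card V : ℝ)^2)) ?_
  · refine le_trans ?_ key
    refine le_trans (le_of_eq ?_) (mul_le_mul_of_nonneg_right hP (by positivity))
    ring
  rintro ⟨x, y⟩ hxy
  simp only [mem_filter, mem_link] at hxy
  have hq := card_link_inter_avoiding_ge hγ hH hγ4 hn hdeg x T.2.1 (insert y U) (by
    have := card_insert_le y U
    have : ((insert y U).card : ℝ) ≤ U.card + 1 := by exact_mod_cast this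
    linarith)
  refine le_trans (mul_le_mul_of_nonneg_right hq (by positivity)) ?_
  refine card_mul_le_card_of_fibers _ _ _ ?_
  rintro ⟨a, b⟩ hab
  simp only [mem_filter, mem_inter, mem_link, mem_insert, not_or] at hab
  refine (card_link_inter_avoiding_ge hγ hH hγ4 hn hdeg y T.2.2 ({x, a, b} ∪ U) (by
    have := (card_union_le {x, a, b} U).trans (Nat.add_le_add_right (card_le_three) _)
    have : ((({x, a, b} : Finset V) ∪ U).card : ℝ) ≤ 3 + U.card := by exact_mod_cast this
    linarith)).trans ?_
  rw [Nat.cast_le]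
  refine card_le_card ?_
  rintro ⟨c, d⟩ hcd
  simp only [mem_filter, mem_inter, mem_link, mem_insert, mem_union, mem_singleton, not_or] at hcd
  have hxy' := distinct_of_mem hH hxy.1
  simp only [mem_filter, mem_univ, true_and, Absorbs, IsGood, mem_link, verts, fstTriple,
    sndTriple, disjoint_left, mem_insert, mem_singleton, mem_union]
  grind

end Counting


omit [Fintype V] in
lemma card_verts_le (t : Gadget V) : (verts t).card ≤ 6 :=
  (card_union_le _ _).trans (Nat.add_le_add card_le_three card_le_three)

omit [Fintype V] in
lemma verts_nonempty (t : Gadget V) : (verts t).Nonempty :=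
  ⟨t.1.1, by simp [verts, fstTriple]⟩

omit [Fintype V] in
lemma card_biUnion_verts_le (S : Finset (Gadget V)) : (S.biUnion verts).card ≤ 6 * S.card := by
  rw [mul_comm]
  exact card_biUnion_le_card_mul _ _ _ fun t _ => card_verts_le t

open scoped Classical in
lemma exists_disjoint_absorbing_family {γ : ℝ} {H : Finset (Finset V)} (hγ : 0 < γ)
    (hH : ∀ e ∈ H, e.card = 3) (hγ4 : γ ≤ 1/4) (hn : 7 ≤ γ * (Fintype.card V : ℝ))
    (hdeg : ∀ v : V, (1/2 + 2*γ) * ((Fintype.card V).choose 2 : ℝ)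
        ≤ ((H.filter fun e => v ∈ e).card : ℝ))
    (m : ℕ) (hm : 6 * (m : ℝ) ≤ γ^3 * Fintype.card V) :
    ∃ S : Finset (Gadget V), S.card = m ∧ (∀ t ∈ S, IsGood H t) ∧
      (S : Set (Gadget V)).PairwiseDisjoint verts ∧
      ∑ T : V × V × V, (1/2 : ℝ) ^ (S.filter fun t => Absorbs H T t).card ≤
        (1 - γ^2/2) ^ m * (Fintype.card V : ℝ)^3 := by
  have hn0 : 0 < (Fintype.card V : ℝ) := by
    by_contra! h
    nlinarith
  have hγ2 : γ^2 ≤ 1 := by nlinarith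
  induction m with
  | zero =>
    refine ⟨∅, by simp, by simp, by simp, ?_⟩
    simp only [filter_empty, card_empty, pow_zero, sum_const, card_univ, Fintype.card_prod,
      nsmul_eq_mul, mul_one, one_mul]
    push_cast
    exact le_of_eq (by ring)
  | succ m ih =>
    push_cast at hm
    obtain ⟨S, hSm, hgood, hdisj, hsum⟩ := ih (by linarith)
    set U := S.biUnion verts with hUdef
    have hU : (U.card : ℝ) ≤ γ^3 * Fintype.card V := by
      have h1 : (U.card : ℝ) ≤ 6 * S.card := by exact_mod_cast card_biUnion_verts_le S
      rw [hSm] at h1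
      linarith
    set C : Finset (Gadget V) := univ.filter fun t => IsGood H t ∧ Disjoint (verts t) U with hC
    set w : V × V × V → ℝ := fun T => (1/2 : ℝ) ^ (S.filter fun t => Absorbs H T t).card with hw
    have hwnn : ∀ T, 0 ≤ w T := fun T => by positivity
    have hCcard : (C.card : ℝ) ≤ (Fintype.card V : ℝ)^6 := by
      have h1 : C.card ≤ Fintype.card (Gadget V) := card_le_univ C
      have h2 : Fintype.card (Gadget V) = Fintype.card V ^ 6 := by
        simp only [Fintype.card_prod]
        ring
      rw [h2] at h1
      exact_mod_cast h1
    have habs : ∀ T, γ^2 * (Fintype.card V : ℝ)^6 ≤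
        ((C.filter fun t => Absorbs H T t).card : ℝ) := by
      intro T
      refine (card_absorbs_ge hγ hH hγ4 hn hdeg T U hU).trans ?_
      rw [Nat.cast_le]
      refine card_le_card fun t ht => ?_
      simp only [hC, mem_filter, mem_univ, true_and] at ht ⊢
      exact ⟨⟨ht.1.1, ht.2⟩, ht.1⟩
    have hCne : C.Nonempty := by
      obtain ⟨v⟩ : Nonempty V := Fintype.card_pos_iff.1 (by exact_mod_cast hn0)
      have h1 := habs (v, v, v)
      have h2 : (0 : ℝ) < ((C.filter fun t => Absorbs H (v, v, v) t).card : ℝ) :=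
        lt_of_lt_of_le (by positivity) h1
      exact (card_pos.1 (by exact_mod_cast h2)).mono (filter_subset _ _)
    have havg : ∑ t ∈ C, ∑ T, w T * (if Absorbs H T t then 1/2 else 1) ≤
        ∑ t ∈ C, (1 - γ^2/2) * ∑ T, w T := by
      rw [sum_comm, sum_const, nsmul_eq_mul, ← mul_assoc, mul_sum]
      refine sum_le_sum fun T _ => ?_
      rw [← mul_sum, mul_comm]
      refine mul_le_mul_of_nonneg_right ?_ (hwnn T)
      have hsplit : ∑ t ∈ C, (if Absorbs H T t then (1/2 : ℝ) else 1) =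
          C.card - (1/2) * (C.filter fun t => Absorbs H T t).card := by
        have : ∀ t, (if Absorbs H T t then (1/2 : ℝ) else 1) =
            1 - (1/2) * (if Absorbs H T t then 1 else 0) := by
          intro t
          split_ifs <;> norm_num
        simp only [this, sum_sub_distrib, ← mul_sum, sum_boole]
        simp
      rw [hsplit]
      have h1 := habs T
      nlinarith [mul_le_mul_of_nonneg_left hCcard (sq_nonneg γ)]
    obtain ⟨t, htC, ht⟩ := exists_le_of_sum_le hCne havg
    simp only [hC, mem_filter, mem_univ, true_and] at htC
    have hdt : ∀ s ∈ S, Disjoint (verts t) (verts s) := fun s hs =>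
      htC.2.mono_right (subset_biUnion_of_mem verts hs)
    have htS : t ∉ S := fun h =>
      (verts_nonempty t).ne_empty (disjoint_self.1 (hdt t h))
    refine ⟨insert t S, by rw [card_insert_of_notMem htS, hSm], ?_, ?_, ?_⟩
    · intro s hs
      rcases mem_insert.1 hs with rfl | hs
      exacts [htC.1, hgood s hs]
    · rw [coe_insert]
      exact hdisj.insert fun s hs _ => hdt s hs
    · calc ∑ T : V × V × V, (1/2 : ℝ) ^ ((insert t S).filter fun t => Absorbs H T t).card
          = ∑ T, w T * (if Absorbs H T t then 1/2 else 1) := by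
            refine sum_congr rfl fun T _ => ?_
            rw [filter_insert]
            split_ifs with h
            · rw [card_insert_of_notMem fun h' => htS (mem_filter.1 h').1, pow_succ]
            · rw [mul_one]
        _ ≤ (1 - γ^2/2) * ∑ T, w T := ht
        _ ≤ (1 - γ^2/2) * ((1 - γ^2/2) ^ m * (Fintype.card V : ℝ)^3) :=
            mul_le_mul_of_nonneg_left hsum (by linarith)
        _ = (1 - γ^2/2) ^ (m + 1) * (Fintype.card V : ℝ)^3 := by ring

/-- Some matching of `H` covers precisely the vertices in `X`. -/
def Covers (H : Finset (Finset V)) (X : Finset V) : Prop :=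
  ∃ M ⊆ H, (M : Set (Finset V)).PairwiseDisjoint id ∧ M.biUnion id = X

omit [Fintype V] in
lemma Covers.union {H : Finset (Finset V)} {X Y : Finset V} (hX : Covers H X) (hY : Covers H Y)
    (hXY : Disjoint X Y) : Covers H (X ∪ Y) := by
  obtain ⟨M, hMH, hM, rfl⟩ := hX
  obtain ⟨N, hNH, hN, rfl⟩ := hY
  refine ⟨M ∪ N, union_subset hMH hNH, ?_, union_biUnion⟩
  rw [coe_union, Set.pairwiseDisjoint_union]
  refine ⟨hM, hN, fun a ha b hb _ => ?_⟩
  exact hXY.mono (subset_biUnion_of_mem id ha) (subset_biUnion_of_mem id hb)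

omit [Fintype V] in
lemma covers_of_mem {H : Finset (Finset V)} {e : Finset V} (he : e ∈ H) : Covers H e :=
  ⟨{e}, by simpa, by simp, by simp⟩

omit [Fintype V] in
lemma covers_biUnion {α : Type*} {H : Finset (Finset V)} (S : Finset α) (f : α → Finset V)
    (hf : ∀ t ∈ S, Covers H (f t)) (hS : (S : Set α).PairwiseDisjoint f) :
    Covers H (S.biUnion f) := by
  classical
  induction S using Finset.induction_on with
  | empty => exact ⟨∅, by simp, by simp, by simp⟩
  | insert t S htS ih =>
    rw [biUnion_insert]
    refine (hf t (mem_insert_self _ _)).union (ih (fun s hs => hf s (mem_insert_of_mem hs))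
      (hS.subset (by simp))) ?_
    rw [disjoint_biUnion_right]
    intro s hs
    exact hS (by simp) (by simp [hs]) fun h => htS (h ▸ hs)

omit [Fintype V] in
lemma IsGood.covers {H : Finset (Finset V)} {t : Gadget V} (ht : IsGood H t) :
    Covers H (verts t) :=
  (covers_of_mem ht.1).union (covers_of_mem ht.2.1) ht.2.2

lemma Absorbs.covers {H : Finset (Finset V)} (hH : ∀ e ∈ H, e.card = 3) {x y z : V}
    {t : Gadget V} (ht : Absorbs H (x, y, z) t) (hxy : x ≠ y) (hxz : x ≠ z) (hyz : y ≠ z)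
    (hd : Disjoint {x, y, z} (verts t)) : Covers H (verts t ∪ {x, y, z}) := by
  obtain ⟨⟨he, hf, hef⟩, h1, h2, h3⟩ := ht
  obtain ⟨⟨u, u'⟩, ⟨a, b⟩, ⟨c, d⟩⟩ := t
  simp only [mem_link, fstTriple, sndTriple, verts] at *
  have := distinct_of_mem hH h1
  have := distinct_of_mem hH h2
  have := distinct_of_mem hH h3
  have := distinct_of_mem hH he
  have := distinct_of_mem hH hf
  simp only [disjoint_left, mem_insert, mem_singleton, mem_union] at hd hef
  have hc := ((covers_of_mem h1).union (covers_of_mem h2) ?_).union (covers_of_mem h3) ?_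
  · convert hc using 1
    ext v
    simp only [mem_insert, mem_singleton, mem_union]
    tauto
  · simp only [disjoint_left, mem_insert, mem_singleton]
    grind
  · simp only [disjoint_left, mem_insert, mem_singleton, mem_union]
    grind

open scoped Classical in
lemma covers_union_of_absorbs {H : Finset (Finset V)} (hH : ∀ e ∈ H, e.card = 3) (k : ℕ)
    (S : Finset (Gadget V)) (hgood : ∀ t ∈ S, IsGood H t)
    (hS : (S : Set (Gadget V)).PairwiseDisjoint verts)
    (habs : ∀ T, k ≤ (S.filter fun t => Absorbs H T t).card)
    (X : Finset V) (hX : X.card = 3 * k) (hXS : Disjoint X (S.biUnion verts)) :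
    Covers H (S.biUnion verts ∪ X) := by
  induction k generalizing S X with
  | zero =>
    obtain rfl : X = ∅ := card_eq_zero.1 (by omega)
    rw [union_empty]
    exact covers_biUnion S verts (fun t ht => (hgood t ht).covers) hS
  | succ k ih =>
    obtain ⟨Y, hYX, hY⟩ := exists_subset_card_eq (s := X) (n := 3) (by omega)
    obtain ⟨x, y, z, hxy, hxz, hyz, rfl⟩ := card_eq_three.1 hY
    obtain ⟨t, ht⟩ : (S.filter fun t => Absorbs H (x, y, z) t).Nonempty :=
      card_pos.1 (lt_of_lt_of_le k.succ_pos (habs _))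
    obtain ⟨htS, htabs⟩ := mem_filter.1 ht
    have hsplit : S.biUnion verts = verts t ∪ (S.erase t).biUnion verts := by
      rw [← biUnion_insert, insert_erase htS]
    rw [hsplit, disjoint_union_right] at hXS
    have h1 := htabs.covers hH hxy hxz hyz (hXS.1.mono_left hYX)
    have h2 := ih (S.erase t) (fun s hs => hgood s (mem_of_mem_erase hs))
      (hS.subset (by simp)) (fun T => by
        have := habs T
        have := pred_card_le_card_erase (s := S.filter fun t => Absorbs H T t) (a := t)
        rw [← filter_erase] at this
        omega) (X \ {x, y, z}) (by rw [card_sdiff_of_subset hYX]; omega)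
      (hXS.2.mono_left sdiff_subset)
    have hdt : Disjoint (verts t) ((S.erase t).biUnion verts) := by
      rw [disjoint_biUnion_right]
      intro s hs
      exact hS htS (mem_of_mem_erase hs) (ne_of_mem_erase hs).symm
    have h3 := h1.union h2 (by
      rw [disjoint_union_left, disjoint_union_right, disjoint_union_right]
      exact ⟨⟨hdt, (hXS.1.mono_left sdiff_subset).symm⟩, hXS.2.mono_left hYX, disjoint_sdiff⟩)
    convert h3 using 1
    rw [hsplit, union_union_union_comm, union_sdiff_of_subset hYX]

lemma exists_cube_mul_exp_lt {c : ℝ} (hc : 0 < c) :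
    ∃ N : ℝ, ∀ x ≥ N, x ^ 3 * Real.exp (-(c * x)) < Real.exp (-1) := by
  have h1 := (Real.tendsto_pow_mul_exp_neg_atTop_nhds_zero 3).comp
    (Filter.tendsto_id.const_mul_atTop hc)
  have h2 := h1.eventually_lt_const (show 0 < c ^ 3 * Real.exp (-1) by positivity)
  obtain ⟨N, hN⟩ := Filter.eventually_atTop.1 h2
  refine ⟨N, fun x hx => ?_⟩
  have h3 := hN x hx
  simp only [Function.comp_apply, id, mul_pow, mul_assoc] at h3
  exact lt_of_mul_lt_mul_left h3 (by positivity)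

lemma le_of_half_pow_le {γ n : ℝ} {m k j : ℕ} (hγ : 0 < γ) (hγ4 : γ ≤ 1/4) (hn : 0 ≤ n)
    (hexp : n ^ 3 * Real.exp (-(γ^5/48 * n)) < Real.exp (-1)) (hm : γ^3 * n / 6 - 1 ≤ m)
    (hk : 3 * (k : ℝ) ≤ γ^6 * n) (h : (1/2 : ℝ)^j ≤ (1 - γ^2/2)^m * n^3) : k ≤ j := by
  by_contra! hjk
  have hγ2 : γ^2 ≤ 1 := by nlinarith
  have hlow : Real.exp (-(γ^5 * n / 16)) ≤ (1/2 : ℝ)^j := by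
    have h1 : (1/2 : ℝ) = Real.exp (-Real.log 2) := by
      rw [Real.exp_neg, Real.exp_log two_pos, one_div]
    rw [h1, ← Real.exp_nat_mul, Real.exp_le_exp]
    have h2 : Real.log 2 < 3/4 := Real.log_two_lt_d9.trans (by norm_num)
    have h3 : (j : ℝ) ≤ k := by exact_mod_cast hjk.le
    have h4 : (j : ℝ) * Real.log 2 ≤ j * (3/4) := by gcongr
    have h5 : γ^6 * n ≤ 1/4 * (γ^5 * n) := by
      have : 0 ≤ γ^5 * n := by positivity
      nlinarith
    linarith
  have hupp : (1 - γ^2/2)^m ≤ Real.exp (1 - γ^5 * n / 12) := by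
    calc (1 - γ^2/2)^m ≤ Real.exp (-(γ^2/2)) ^ m := by
          refine pow_le_pow_left₀ (by linarith) ?_ m
          linarith [Real.add_one_le_exp (-(γ^2/2))]
      _ = Real.exp (m * (-(γ^2/2))) := (Real.exp_nat_mul _ _).symm
      _ ≤ Real.exp (1 - γ^5 * n / 12) := by
          rw [Real.exp_le_exp]
          nlinarith [mul_le_mul_of_nonneg_right hm (sq_nonneg γ)]
  have h1 : Real.exp (-(γ^5 * n / 16)) ≤ Real.exp (1 - γ^5 * n / 12) * n^3 :=
    hlow.trans (h.trans (mul_le_mul_of_nonneg_right hupp (by positivity)))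
  have h2 : Real.exp (1 - γ^5 * n / 12) * n^3 =
      Real.exp (1 - γ^5 * n / 16) * (n^3 * Real.exp (-(γ^5/48 * n))) := by
    rw [mul_left_comm, ← Real.exp_add, mul_comm]
    ring_nf
  have h3 : Real.exp (1 - γ^5 * n / 16) * (n^3 * Real.exp (-(γ^5/48 * n))) <
      Real.exp (1 - γ^5 * n / 16) * Real.exp (-1) :=
    mul_lt_mul_of_pos_left hexp (Real.exp_pos _)
  have h4 : Real.exp (1 - γ^5 * n / 16) * Real.exp (-1) = Real.exp (-(γ^5 * n / 16)) := by
    rw [← Real.exp_add]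
    ring_nf
  linarith

end Absorbing

/-- Hàn–Person–Schacht absorbing lemma. For every `γ > 0` there is `n₀`
such that every 3-uniform hypergraph `H` on `n ≥ n₀` vertices with minimum vertex degree
at least `(1/2 + 2γ)C(n,2)` contains a matching `M*` of size at most `γ³n/3` such that
for every vertex set `V'` disjoint from `V(M*)` with `|V'| ≤ γ⁶n` divisible by 3, there
is a matching in `H` covering precisely the vertices in `V(M*) ∪ V'`. -/
theorem stmt_8 (γ : ℝ) (hγ : 0 < γ) :
    ∃ n₀ : ℕ, ∀ (V : Type) [Fintype V] [DecidableEq V] (H : Finset (Finset V)),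
      (∀ e ∈ H, e.card = 3) →
      n₀ ≤ Fintype.card V →
      (∀ v : V, (1/2 + 2*γ) * ((Fintype.card V).choose 2 : ℝ)
        ≤ ((H.filter fun e => v ∈ e).card : ℝ)) →
      ∃ M ⊆ H, (M : Set (Finset V)).PairwiseDisjoint id ∧
        (M.card : ℝ) ≤ γ^3 * (Fintype.card V : ℝ) / 3 ∧
        ∀ V' : Finset V, V' ⊆ Finset.univ \ M.biUnion id →
          (V'.card : ℝ) ≤ γ^6 * (Fintype.card V : ℝ) → 3 ∣ V'.card →
          ∃ M' ⊆ H, (M' : Set (Finset V)).PairwiseDisjoint id ∧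
            M'.biUnion id = M.biUnion id ∪ V' := by
  classical
  obtain ⟨N, hN⟩ := Absorbing.exists_cube_mul_exp_lt (show 0 < γ^5/48 by positivity)
  obtain ⟨n₀, hn₀⟩ := exists_nat_ge (max N (7 / γ))
  refine ⟨max n₀ 2, fun V _ _ H hH hn hdeg => ?_⟩
  have hn₀' : (n₀ : ℝ) ≤ Fintype.card V := by exact_mod_cast (le_max_left _ _).trans hn
  have hγ4 := Absorbing.le_quarter_of_degree hH ((le_max_right _ _).trans hn) hdeg
  have hNn : N ≤ Fintype.card V := (le_max_left _ _).trans (hn₀.trans hn₀')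
  have h7 : 7 ≤ γ * (Fintype.card V : ℝ) := by
    rw [← div_le_iff₀' hγ]
    exact (le_max_right _ _).trans (hn₀.trans hn₀')
  set m := ⌊γ^3 * (Fintype.card V : ℝ) / 6⌋₊
  have hm : (m : ℝ) ≤ γ^3 * (Fintype.card V : ℝ) / 6 := Nat.floor_le (by positivity)
  have hm' : γ^3 * (Fintype.card V : ℝ) / 6 - 1 ≤ m := (Nat.sub_one_lt_floor _).le
  obtain ⟨S, hSm, hgood, hdisj, hsum⟩ :=
    Absorbing.exists_disjoint_absorbing_family hγ hH hγ4 h7 hdeg m (by linarith)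
  obtain ⟨M, hMH, hM, hMS⟩ :=
    Absorbing.covers_biUnion S Absorbing.verts (fun t ht => (hgood t ht).covers) hdisj
  refine ⟨M, hMH, hM, ?_, ?_⟩
  · have h1 : (M.biUnion id).card = M.card * 3 := by
      rw [card_biUnion hM]
      exact sum_const_nat fun e he => hH e (hMH he)
    have h2 := Absorbing.card_biUnion_verts_le S
    rw [← hMS, h1, hSm] at h2
    have h3 : (M.card : ℝ) * 3 ≤ 6 * m := by exact_mod_cast h2
    linarith
  · intro X hX hXcard h3
    obtain ⟨k, hk⟩ := h3
    rw [hMS] at hX ⊢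
    refine Absorbing.covers_union_of_absorbs hH k S hgood hdisj (fun T => ?_) X hk ?_
    · have hk' : 3 * (k : ℝ) ≤ γ^6 * (Fintype.card V : ℝ) := by
        rw [hk] at hXcard
        exact_mod_cast hXcard
      refine Absorbing.le_of_half_pow_le hγ hγ4 (Nat.cast_nonneg _) (hN _ hNn) hm' hk'
        (le_trans ?_ hsum)
      exact single_le_sum (f := fun T => (1/2 : ℝ) ^ (S.filter fun t =>
        Absorbing.Absorbs H T t).card) (fun T _ => by positivity) (mem_univ T)
    · exact disjoint_sdiff_self_left.mono_left hX
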